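/- There exists a non-degenerate ranking problem such that for every ranking policy π maximizing the overall utility U(π) over all ranking policies and every ranking σ with π(σ) > 0, the amount of intent covered by σ is strictly less than the maximum coverable intent. -/

import Mathlib

open Finset

/-- A ranking problem in a two-sided market: finite nonempty sets of items, intents,
user groups; a partition of the items into item groups; group proportions; per-group
intent distributions; a nonnegative relevance function; and a nonnegative exposure
function on positions with positive total exposure. -/
structure RankingProblem where
  Item : Type
  Intent : Type
  UserGrp : Type
  ItemGrp : Type
  [itemFin : Fintype Item]
  [itemDec : DecidableEq Item]
  [intentFin : Fintype Intent]
  [userFin : Fintype UserGrp]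
  [itemGrpFin : Fintype ItemGrp]
  [itemGrpDec : DecidableEq ItemGrp]
  [itemNe : Nonempty Item]
  [intentNe : Nonempty Intent]
  [userNe : Nonempty UserGrp]
  /-- group proportion of each user group -/
  ρ : UserGrp → ℝ
  ρ_nonneg : ∀ g, 0 ≤ ρ g
  ρ_sum : ∑ g, ρ g = 1
  /-- the item group of each item; this partitions the items, each group being nonempty -/
  grp : Item → ItemGrp
  grp_surj : Function.Surjective grp
  /-- intent distribution of each user group -/
  intentDist : UserGrp → Intent → ℝ
  intentDist_nonneg : ∀ g i, 0 ≤ intentDist g i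
  intentDist_sum : ∀ g, ∑ i, intentDist g i = 1
  /-- relevance of each item to each intent -/
  rel : Item → Intent → ℝ
  rel_nonneg : ∀ d i, 0 ≤ rel d i
  /-- exposure of each position -/
  expo : Fin (Fintype.card Item) → ℝ
  expo_nonneg : ∀ n, 0 ≤ expo n
  expo_sum_pos : 0 < ∑ n, expo n

attribute [instance] RankingProblem.itemFin RankingProblem.itemDec
  RankingProblem.intentFin RankingProblem.userFin RankingProblem.itemGrpFin
  RankingProblem.itemGrpDec RankingProblem.itemNe RankingProblem.intentNe
  RankingProblem.userNe

namespace RankingProblem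

variable (P : RankingProblem)

/-- A ranking is a bijection from items onto positions. -/
abbrev Ranking := P.Item ≃ Fin (Fintype.card P.Item)

/-- The overall intent distribution I_U(i) = Σ_UG ρ_UG · I_UG(i). -/
noncomputable def overallIntent (i : P.Intent) : ℝ := ∑ g, P.ρ g * P.intentDist g i

/-- Utility of a ranking for an intent: U(σ|i) = Σ_d e(σ(d))·r(d,i). -/
noncomputable def intentUtil (σ : P.Ranking) (i : P.Intent) : ℝ :=
  ∑ d, P.expo (σ d) * P.rel d i

/-- A ranking policy: a (finitely supported) probability distribution over rankings. -/
def IsPolicy (π : P.Ranking → ℝ) : Prop := (∀ σ, 0 ≤ π σ) ∧ ∑ σ, π σ = 1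

/-- Utility of a policy for a user group. -/
noncomputable def groupUtil (π : P.Ranking → ℝ) (g : P.UserGrp) : ℝ :=
  ∑ σ, π σ * ∑ i, P.intentDist g i * P.intentUtil σ i

/-- Overall utility of a policy. -/
noncomputable def utility (π : P.Ranking → ℝ) : ℝ := ∑ g, P.ρ g * P.groupUtil π g

/-- Utility of a policy for an item group. -/
noncomputable def itemGroupUtil (π : P.Ranking → ℝ) (dg : P.ItemGrp) : ℝ :=
  ∑ σ, π σ * ∑ i, P.overallIntent i *
    ∑ d ∈ univ.filter (fun d => P.grp d = dg), P.expo (σ d) * P.rel d i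

/-- Average exposure of an item group under a policy. -/
noncomputable def groupExposure (π : P.Ranking → ℝ) (dg : P.ItemGrp) : ℝ :=
  (∑ σ, π σ * ∑ d ∈ univ.filter (fun d => P.grp d = dg), P.expo (σ d)) /
    (univ.filter (fun d => P.grp d = dg)).card

/-- Expected relevance of an item to the whole user population. -/
noncomputable def expRel (d : P.Item) : ℝ := ∑ i, P.overallIntent i * P.rel d i

/-- Non-degeneracy of a ranking problem. -/
def NonDegenerate : Prop :=
  (∀ g, 0 < P.ρ g) ∧ (∀ i, 0 < P.overallIntent i) ∧
    (∀ i, ∃ d, 0 < P.rel d i) ∧ (∀ dg, ∃ d, P.grp d = dg ∧ 0 < P.expRel d)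

/-- The amount of intent covered by a ranking. -/
noncomputable def coverage (σ : P.Ranking) : ℝ :=
  ∑ i ∈ univ.filter (fun i => 0 < P.intentUtil σ i), P.overallIntent i

instance : Nonempty P.Ranking := ⟨Fintype.equivFin P.Item⟩

/-- The maximum amount of intent coverable by any ranking. -/
noncomputable def maxCoverage : ℝ := ⨆ σ : P.Ranking, P.coverage σ

/-- Items are ranked by expected relevance within each item group under π. -/
def RankedByExpRel (π : P.Ranking → ℝ) : Prop :=
  ∀ σ, 0 < π σ → ∀ dm dn, P.grp dm = P.grp dn → P.expRel dn < P.expRel dm →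
    P.expo (σ dn) ≤ P.expo (σ dm)

/-- User fairness of a policy with respect to a concave increasing function f. -/
noncomputable def userFairness (f : ℝ → ℝ) (π : P.Ranking → ℝ) : ℝ :=
  ∑ g, P.ρ g * f (P.groupUtil π g)

/-- Diversity of a single ranking with respect to a concave increasing function g. -/
noncomputable def rankDiversity (gf : ℝ → ℝ) (σ : P.Ranking) : ℝ :=
  ∑ i, P.overallIntent i * gf (P.intentUtil σ i)

/-- Diversity of a policy. -/
noncomputable def diversity (gf : ℝ → ℝ) (π : P.Ranking → ℝ) : ℝ :=
  ∑ σ, π σ * P.rankDiversity gf σ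

/-- π maximizes the overall utility over all ranking policies. -/
def MaxUtil (π : P.Ranking → ℝ) : Prop :=
  P.IsPolicy π ∧ ∀ π', P.IsPolicy π' → P.utility π' ≤ P.utility π

/-- π maximizes user fairness over all ranking policies. -/
def MaxUF (f : ℝ → ℝ) (π : P.Ranking → ℝ) : Prop :=
  P.IsPolicy π ∧ ∀ π', P.IsPolicy π' → P.userFairness f π' ≤ P.userFairness f π

/-- π maximizes diversity over all ranking policies. -/
def MaxDiv (gf : ℝ → ℝ) (π : P.Ranking → ℝ) : Prop :=
  P.IsPolicy π ∧ ∀ π', P.IsPolicy π' → P.diversity gf π' ≤ P.diversity gf π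

/-- π satisfies the disparate treatment constraints with merit function M. -/
def SatDT (M : P.ItemGrp → ℝ) (π : P.Ranking → ℝ) : Prop :=
  ∀ dg1 dg2, P.groupExposure π dg1 / M dg1 = P.groupExposure π dg2 / M dg2

/-- π maximizes overall utility among policies satisfying the disparate treatment
constraints with merit function M. -/
def MaxUtilDT (M : P.ItemGrp → ℝ) (π : P.Ranking → ℝ) : Prop :=
  P.IsPolicy π ∧ P.SatDT M π ∧
    ∀ π', P.IsPolicy π' → P.SatDT M π' → P.utility π' ≤ P.utility π

/-- π dominates π' for the user groups. -/
def DominatesUsers (π π' : P.Ranking → ℝ) : Prop :=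
  (∀ g, P.groupUtil π' g ≤ P.groupUtil π g) ∧ ∃ g, P.groupUtil π' g < P.groupUtil π g

/-- π is Pareto efficient for the user groups. -/
def ParetoUsers (π : P.Ranking → ℝ) : Prop :=
  ¬ ∃ π', P.IsPolicy π' ∧ P.DominatesUsers π' π

/-- σ dominates σ' for the intents. -/
def DominatesIntents (σ σ' : P.Ranking) : Prop :=
  (∀ i, P.intentUtil σ' i ≤ P.intentUtil σ i) ∧ ∃ i, P.intentUtil σ' i < P.intentUtil σ i

/-- σ is Pareto efficient for the intents. -/
def ParetoIntents (σ : P.Ranking) : Prop := ¬ ∃ σ', P.DominatesIntents σ' σ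

end RankingProblem
/-- Two items, two intents, one user group; item 0 is very relevant to the rare intent 0, item 1
is mildly relevant to the frequent intent 1, and only the first position has exposure. -/
noncomputable def exProblem : RankingProblem where
  Item := Fin 2
  Intent := Fin 2
  UserGrp := Unit
  ItemGrp := Unit
  ρ := fun _ => 1
  ρ_nonneg := fun _ => zero_le_one
  ρ_sum := by simp
  grp := fun _ => ()
  grp_surj := fun _ => ⟨0, rfl⟩
  intentDist := fun _ i => if i = 0 then 1/4 else 3/4
  intentDist_nonneg := fun _ i => by split_ifs <;> norm_num
  intentDist_sum := fun _ => by norm_num [Fin.sum_univ_two]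
  rel := fun d i => if d = i then (if i = 0 then 12 else 1) else 0
  rel_nonneg := fun d i => by split_ifs <;> norm_num
  expo := fun n => if n.val = 0 then 1 else 0
  expo_nonneg := fun n => by split_ifs <;> norm_num
  expo_sum_pos := by
    change (0:ℝ) < ∑ n : Fin 2, if n.val = 0 then (1:ℝ) else 0
    norm_num [Fin.sum_univ_two]

lemma exOverall (i : Fin 2) :
    exProblem.overallIntent i = if i = 0 then 1/4 else 3/4 := by
  change ∑ _g : Unit, (1:ℝ) * (if i = 0 then 1/4 else 3/4) = _
  simp

lemma exUtil (σ : Fin 2 ≃ Fin 2) (i : Fin 2) :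
    exProblem.intentUtil σ i =
      if (σ i).val = 0 then (if i = 0 then 12 else 1) else 0 := by
  change ∑ d : Fin 2, (if (σ d).val = 0 then (1:ℝ) else 0) *
    (if d = i then (if i = 0 then 12 else 1) else 0) = _
  rw [Finset.sum_eq_single i (fun d _ hd => by simp [hd]) (by simp), if_pos rfl, ite_mul, one_mul,
    zero_mul]

lemma exUtility (π : (Fin 2 ≃ Fin 2) → ℝ) :
    exProblem.utility π =
      ∑ σ : Fin 2 ≃ Fin 2, π σ * (if (σ 0).val = 0 then 3 else 3/4) := by
  change ∑ _g : Unit, (1:ℝ) * (∑ σ : Fin 2 ≃ Fin 2, π σ * ∑ i : Fin 2,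
    (if i = 0 then (1/4:ℝ) else 3/4) * exProblem.intentUtil σ i) = _
  simp only [exUtil, Finset.univ_unique, Finset.sum_singleton, one_mul]
  refine Finset.sum_congr rfl fun σ _ => ?_
  congr 1
  have h : σ 0 ≠ σ 1 := fun h => by simpa using σ.injective h
  rw [Fin.sum_univ_two]
  rcases Fin.exists_fin_two.mp ⟨σ 0, rfl⟩ with h0 | h0 <;>
  rcases Fin.exists_fin_two.mp ⟨σ 1, rfl⟩ with h1 | h1 <;>
  simp_all <;> norm_num

lemma exCoverage (σ : Fin 2 ≃ Fin 2) :
    exProblem.coverage σ = if (σ 0).val = 0 then 1/4 else 3/4 := by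
  classical
  have key : exProblem.coverage σ = ∑ i : Fin 2,
      if 0 < exProblem.intentUtil σ i then exProblem.overallIntent i else 0 := by
    unfold RankingProblem.coverage
    rw [Finset.sum_filter]
    refine Finset.sum_congr rfl fun i _ => ?_
    congr
  rw [key, Fin.sum_univ_two, exOverall, exOverall, exUtil, exUtil]
  have h : σ 0 ≠ σ 1 := fun h => by simpa using σ.injective h
  rcases Fin.exists_fin_two.mp ⟨σ 0, rfl⟩ with h0 | h0 <;>
  rcases Fin.exists_fin_two.mp ⟨σ 1, rfl⟩ with h1 | h1 <;>
  simp_all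

/-- There exists a non-degenerate ranking problem such that for every utility-maximizing
policy, every ranking in its support covers strictly less than the maximum coverable
intent. -/
theorem stmt5 :
    ∃ P : RankingProblem, P.NonDegenerate ∧
      ∀ π : P.Ranking → ℝ, P.MaxUtil π →
        ∀ σ, 0 < π σ → P.coverage σ < P.maxCoverage := by
  refine ⟨exProblem, ⟨fun _ => one_pos, ?_, ?_, ?_⟩, ?_⟩
  · intro (i : Fin 2)
    rw [exOverall i]
    split_ifs <;> norm_num
  · intro (i : Fin 2)
    refine ⟨i, ?_⟩
    change (0:ℝ) < if i = i then (if i = (0 : Fin 2) then 12 else 1) else 0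
    rw [if_pos rfl]
    split_ifs <;> norm_num
  · intro dg
    refine ⟨(0 : Fin 2), rfl, ?_⟩
    change (0:ℝ) < ∑ i : Fin 2, exProblem.overallIntent i *
      (if (0 : Fin 2) = i then (if i = 0 then 12 else 1) else 0)
    simp [exOverall]
  · intro (π : (Fin 2 ≃ Fin 2) → ℝ) hπ (σ : Fin 2 ≃ Fin 2) hσ
    obtain ⟨⟨hnn, hsum⟩, hmax⟩ := hπ
    replace hnn : ∀ τ : Fin 2 ≃ Fin 2, 0 ≤ π τ := hnn
    replace hsum : ∑ τ : Fin 2 ≃ Fin 2, π τ = 1 := hsum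
    have hpure := hmax (fun τ : Fin 2 ≃ Fin 2 => if τ = Equiv.refl _ then (1:ℝ) else 0)
      ⟨fun τ => by dsimp only; split_ifs <;> norm_num, by
        change ∑ τ : Fin 2 ≃ Fin 2, (if τ = Equiv.refl _ then (1:ℝ) else 0) = 1
        simp⟩
    rw [exUtility, exUtility] at hpure
    have h3 : (3:ℝ) ≤ ∑ τ : Fin 2 ≃ Fin 2, π τ * (if (τ 0).val = 0 then 3 else 3/4) := by
      refine le_trans (le_of_eq ?_) hpure
      rw [Finset.sum_eq_single (Equiv.refl (Fin 2)) (fun d _ hd => by simp [hd]) (by simp)]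
      simp
    have hσ0 : (σ 0).val = 0 := by
      by_contra hne
      have : ∑ τ : Fin 2 ≃ Fin 2, π τ * (if (τ 0).val = 0 then 3 else 3/4)
          < ∑ τ : Fin 2 ≃ Fin 2, π τ * 3 := by
        refine Finset.sum_lt_sum (fun τ _ => ?_) ⟨σ, Finset.mem_univ _, ?_⟩
        · refine mul_le_mul_of_nonneg_left ?_ (hnn τ)
          split_ifs <;> norm_num
        · rw [if_neg hne]
          exact mul_lt_mul_of_pos_left (by norm_num) hσ
      rw [← Finset.sum_mul, hsum] at this
      linarith
    let τ : Fin 2 ≃ Fin 2 := Equiv.swap 0 1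
    have hle : exProblem.coverage τ ≤ exProblem.maxCoverage :=
      le_ciSup (f := exProblem.coverage) (Set.finite_range _).bddAbove
        τ
    refine lt_of_lt_of_le ?_ hle
    rw [exCoverage, exCoverage, if_pos hσ0, if_neg (by simp [τ])]
    norm_num
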